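/- arXiv:1307.5411 — 4 statements merged into one kernel-verified Lean document; each statement's English description precedes it below -/
import Mathlib

section
/- For every positive integer n, the characteristic polynomial of the adjacency matrix of the friendship graph F_n equals (x+1)(x^2-1)^{n-1}(x^2-x-2n); consequently the adjacency spectrum of F_n is {((1-√(1+8n))/2)^1, (-1)^n, (1)^{n-1}, ((1+√(1+8n))/2)^1} (exponents denoting multiplicities). -/
open Polynomial

/-- The adjacency matrix of a simple graph, with entries in `R`. -/
noncomputable def adjMat (R : Type*) [Zero R] [One R] {V : Type*} [Fintype V]
    (G : SimpleGraph V) : Matrix V V R :=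
  letI := Classical.decRel G.Adj
  G.adjMatrix R

/-- The friendship graph `F n`: `n` triangles glued at the common vertex `none`. -/
def friendshipGraph (n : ℕ) : SimpleGraph (Option (Fin n × Bool)) :=
  SimpleGraph.fromRel (fun u v =>
    u = none ∨ ∃ i : Fin n, u = some (i, true) ∧ v = some (i, false))

/-- Two finite graphs are cospectral if their real adjacency matrices have the same
characteristic polynomial. -/
def Cospectral {V W : Type*} [Fintype V] [Fintype W] [DecidableEq V] [DecidableEq W]
    (G : SimpleGraph V) (H : SimpleGraph W) : Prop :=
  (adjMat ℝ G).charpoly = (adjMat ℝ H).charpoly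

open Classical in
lemma adjMat_apply (R : Type*) [Zero R] [One R] {V : Type*} [Fintype V] (G : SimpleGraph V)
    (u v : V) : adjMat R G u v = if G.Adj u v then 1 else 0 := by
  simp [adjMat, SimpleGraph.adjMatrix, Matrix.of_apply]

open Matrix in
/-- If a square matrix has constant row sums `r`, bordering it by a column of `b`s, a row of `c`s
and a corner entry `d` multiplies its determinant by `r * d - b * c * m` over `r`, where `m` is
the size of the matrix. -/
lemma Matrix.det_bordered_mul_row_sum {R m : Type*} [CommRing R] [Fintype m] [DecidableEq m]
    (A : Matrix m m R) (r b c d : R) (hA : ∀ i, ∑ j, A i j = r) :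
    (fromBlocks A (of fun _ (_ : Unit) => b) (of fun (_ : Unit) _ => c)
        (of fun _ (_ : Unit) => d)).det * r
      = A.det * (r * d - b * c * Fintype.card m) := by
  have h : fromBlocks A (of fun _ (_ : Unit) => b) (of fun (_ : Unit) _ => c)
        (of fun _ (_ : Unit) => d)
      * fromBlocks 1 (of fun _ (_ : Unit) => -b) 0 (of fun _ (_ : Unit) => r)
      = fromBlocks A 0 (of fun (_ : Unit) _ => c)
        (of fun _ (_ : Unit) => r * d - b * c * Fintype.card m) := by
    rw [fromBlocks_multiply]
    congr 1
    · simp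
    · ext i j
      simp [mul_apply, ← Finset.sum_mul, hA]
      ring
    · simp
    · ext i j
      simp [mul_apply]
      ring
  have hdet := congrArg det h
  rw [det_mul, det_fromBlocks_zero₂₁, det_fromBlocks_zero₁₂] at hdet
  simpa using hdet

/-- The vertices of the friendship graph, with the centre listed last. -/
def friendshipVertexEquiv (n : ℕ) : (Fin 2 × Fin n) ⊕ Unit ≃ Option (Fin n × Bool) :=
  (Equiv.sumCongr ((Equiv.prodComm _ _).trans (Equiv.prodCongr (Equiv.refl _) finTwoEquiv))
    (Equiv.refl Unit)).trans (Equiv.optionEquivSumPUnit _).symm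

open Matrix in
lemma charmatrix_friendshipGraph (n : ℕ) :
    (charmatrix (adjMat ℝ (friendshipGraph n))).submatrix
        (friendshipVertexEquiv n) (friendshipVertexEquiv n)
      = fromBlocks (blockDiagonal fun _ : Fin n => !![(X : ℝ[X]), -1; -1, X])
        (of fun _ (_ : Unit) => -1) (of fun (_ : Unit) _ => -1) (of fun _ (_ : Unit) => X) := by
  ext1 u v
  rcases u with ⟨a, i⟩ | u <;> rcases v with ⟨b, j⟩ | v
  · by_cases hij : i = j
    · subst hij
      fin_cases a <;> fin_cases b <;>
        simp [friendshipVertexEquiv, adjMat_apply, friendshipGraph, blockDiagonal_apply,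
          finTwoEquiv]
    · fin_cases a <;> fin_cases b <;>
        simp [friendshipVertexEquiv, adjMat_apply, friendshipGraph, hij, Ne.symm hij,
          blockDiagonal_apply, finTwoEquiv]
  all_goals simp [friendshipVertexEquiv, adjMat_apply, friendshipGraph]

lemma charpoly_friendshipGraph_mul (n : ℕ) :
    (adjMat ℝ (friendshipGraph n)).charpoly * (X - 1)
      = (X ^ 2 - 1) ^ n * (X ^ 2 - X - C (2 * (n : ℝ))) := by
  rw [Matrix.charpoly, ← Matrix.det_submatrix_equiv_self (friendshipVertexEquiv n),
    charmatrix_friendshipGraph, Matrix.det_bordered_mul_row_sum]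
  · simp [Matrix.det_blockDiagonal, Matrix.det_fin_two, ← map_ofNat C 2]
    ring
  · rintro ⟨a, i⟩
    fin_cases a <;> simp [Fintype.sum_prod_type, Matrix.blockDiagonal_apply] <;> ring

lemma charpoly_friendshipGraph (n : ℕ) (hn : 0 < n) :
    (adjMat ℝ (friendshipGraph n)).charpoly
      = (X + 1) * (X ^ 2 - 1) ^ (n - 1) * (X ^ 2 - X - C (2 * (n : ℝ))) := by
  refine mul_right_cancel₀ (X_sub_C_ne_zero (1 : ℝ)) ?_
  rw [C_1, charpoly_friendshipGraph_mul]
  obtain ⟨k, rfl⟩ := Nat.exists_eq_succ_of_ne_zero hn.ne'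
  rw [Nat.succ_sub_one, pow_succ]
  ring

lemma X_sq_sub_X_sub_C_eq_mul {t : ℝ} (ht : 0 ≤ 1 + 4 * t) :
    (X ^ 2 - X - C t : ℝ[X])
      = (X - C ((1 - Real.sqrt (1 + 4 * t)) / 2)) * (X - C ((1 + Real.sqrt (1 + 4 * t)) / 2)) := by
  have hsum : (1 - Real.sqrt (1 + 4 * t)) / 2 + (1 + Real.sqrt (1 + 4 * t)) / 2 = 1 := by ring
  have hprod : (1 - Real.sqrt (1 + 4 * t)) / 2 * ((1 + Real.sqrt (1 + 4 * t)) / 2) = -t := by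
    linear_combination (-1 / 4) * Real.sq_sqrt ht
  have hsumC := congrArg C hsum
  have hprodC := congrArg C hprod
  rw [C_add, C_1] at hsumC
  rw [C_mul, C_neg] at hprodC
  linear_combination X * hsumC - hprodC

/-- the characteristic polynomial of the adjacency matrix of `F n` is
`(x+1)(x²-1)^{n-1}(x²-x-2n)`, and consequently its spectrum (the multiset of roots) is
`{(1-√(1+8n))/2, (-1)ⁿ, 1^{n-1}, (1+√(1+8n))/2}`. -/
theorem friendship_charpoly_and_spectrum (n : ℕ) (hn : 0 < n) :
    (adjMat ℝ (friendshipGraph n)).charpoly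
      = (X + 1) * (X ^ 2 - 1) ^ (n - 1) * (X ^ 2 - X - C (2 * (n : ℝ))) ∧
    (adjMat ℝ (friendshipGraph n)).charpoly.roots
      = {(1 - Real.sqrt (1 + 8 * (n : ℝ))) / 2} + Multiset.replicate n (-1)
        + Multiset.replicate (n - 1) 1 + {(1 + Real.sqrt (1 + 8 * (n : ℝ))) / 2} := by
  refine ⟨charpoly_friendshipGraph n hn, ?_⟩
  rw [charpoly_friendshipGraph n hn, X_sq_sub_X_sub_C_eq_mul (by positivity),
    show 1 + 4 * (2 * (n : ℝ)) = 1 + 8 * n by ring]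
  conv_rhs => rw [← roots_multiset_prod_X_sub_C ({(1 - Real.sqrt (1 + 8 * (n : ℝ))) / 2} + _ + _ + _)]
  congr 1
  obtain ⟨k, rfl⟩ := Nat.exists_eq_succ_of_ne_zero hn.ne'
  simp only [Multiset.map_add, Multiset.prod_add, Multiset.map_singleton, Multiset.prod_singleton,
    Multiset.map_replicate, Multiset.prod_replicate, C_neg, C_1, Nat.succ_sub_one, pow_succ _ k]
  rw [show (X ^ 2 - 1 : ℝ[X]) = (X - -1) * (X - 1) by ring, mul_pow]
  ring
end

section
/- Let n be a positive integer and let G be a graph cospectral with the friendship graph F_n. If G contains no cycle of length 4 as a (not necessarily induced) subgraph, then G is isomorphic to F_n. -/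
open Polynomial

/-- The trace of the `k`-th power of a real symmetric matrix is the sum of the `k`-th powers of the
roots of its characteristic polynomial. -/
theorem Matrix.IsHermitian.trace_pow_eq_sum_roots {V : Type*} [Fintype V] [DecidableEq V]
    {A : Matrix V V ℝ} (hA : A.IsHermitian) (k : ℕ) :
    (A ^ k).trace = (A.charpoly.roots.map (· ^ k)).sum := by
  rw [hA.roots_charpoly_eq_eigenvalues]
  conv_lhs => rw [hA.spectral_theorem, ← map_pow, Matrix.diagonal_pow, Unitary.conjStarAlgAut_apply,
    Matrix.trace_mul_cycle, Unitary.coe_star_mul_self, one_mul, Matrix.trace_diagonal]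
  simp

namespace SimpleGraph

/-- Any two distinct vertices have at most one common neighbour. -/
def AtMostOneCommonNeighbor {V : Type*} (G : SimpleGraph V) : Prop :=
  ∀ ⦃a c b d : V⦄, a ≠ c → G.Adj a b → G.Adj c b → G.Adj a d → G.Adj c d → b = d

theorem adjMat_eq_adjMatrix {V : Type*} [Fintype V] (G : SimpleGraph V) [DecidableRel G.Adj]
    (R : Type*) [Zero R] [One R] : adjMat R G = G.adjMatrix R := by
  unfold adjMat
  congr!

section Counting

variable {V : Type*} [Fintype V] [DecidableEq V] (G : SimpleGraph V) [DecidableRel G.Adj]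

theorem adjMatrix_mul_self_apply (u v : V) :
    (G.adjMatrix ℝ * G.adjMatrix ℝ) u v = (G.neighborFinset u ∩ G.neighborFinset v).card := by
  rw [adjMatrix_mul_apply]
  simp only [adjMatrix_apply, Finset.sum_boole]
  congr 2
  ext x
  simp [adj_comm]

theorem sum_card_inter_neighborFinset :
    ∑ u, ∑ v, (G.neighborFinset u ∩ G.neighborFinset v).card = ∑ v, G.degree v ^ 2 := by
  have h (u v : V) : (G.neighborFinset u ∩ G.neighborFinset v).card =
      ∑ x, (if G.Adj x u then 1 else 0) * (if G.Adj x v then 1 else 0) := by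
    simp only [ite_zero_mul_ite_zero, mul_one, Finset.sum_boole, Nat.cast_id]
    congr 1
    ext x
    simp [adj_comm]
  have hd (x : V) : (∑ u, if G.Adj x u then 1 else 0) = G.degree x := by
    rw [Finset.sum_boole, ← card_neighborFinset_eq_degree, neighborFinset_eq_filter, Nat.cast_id]
  calc _ = ∑ u, ∑ x, ∑ v, (if G.Adj x u then 1 else 0) * (if G.Adj x v then 1 else 0) := by
        simp_rw [h]
        exact Finset.sum_congr rfl fun u _ => Finset.sum_comm
    _ = ∑ x, (∑ u, if G.Adj x u then 1 else 0) * ∑ v, (if G.Adj x v then 1 else 0) := by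
        rw [Finset.sum_comm]
        simp_rw [Finset.sum_mul_sum]
    _ = _ := by simp_rw [hd, sq]

variable {G}

theorem AtMostOneCommonNeighbor.card_inter_le (hG : G.AtMostOneCommonNeighbor) {u v : V}
    (huv : u ≠ v) : (G.neighborFinset u ∩ G.neighborFinset v).card ≤ 1 := by
  refine Finset.card_le_one.2 fun a ha b hb => ?_
  simp only [Finset.mem_inter, mem_neighborFinset] at ha hb
  exact hG huv ha.1 ha.2 hb.1 hb.2

variable (G) in
theorem trace_adjMatrix_sq : (G.adjMatrix ℝ ^ 2).trace = ∑ v, (G.degree v : ℝ) := by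
  rw [sq, Matrix.trace]
  exact Finset.sum_congr rfl fun v _ => G.adjMatrix_mul_self_apply_self v

theorem AtMostOneCommonNeighbor.trace_adjMatrix_pow_four (hG : G.AtMostOneCommonNeighbor) :
    (G.adjMatrix ℝ ^ 4).trace + ∑ v, (G.degree v : ℝ) = 2 * ∑ v, (G.degree v : ℝ) ^ 2 := by
  have h4 : (G.adjMatrix ℝ ^ 4).trace =
      ∑ u, ∑ v, ((G.neighborFinset u ∩ G.neighborFinset v).card : ℝ) ^ 2 := by
    rw [show 4 = 2 + 2 from rfl, pow_add, sq, Matrix.trace]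
    refine Finset.sum_congr rfl fun u _ => ?_
    rw [Matrix.diag_apply, Matrix.mul_apply]
    refine Finset.sum_congr rfl fun v _ => ?_
    rw [adjMatrix_mul_self_apply, adjMatrix_mul_self_apply, Finset.inter_comm, sq]
  have hsum := G.sum_card_inter_neighborFinset
  have key (u : V) : ∑ v, (G.neighborFinset u ∩ G.neighborFinset v).card ^ 2 + G.degree u =
      ∑ v, (G.neighborFinset u ∩ G.neighborFinset v).card + G.degree u ^ 2 := by
    rw [← Finset.add_sum_erase _ _ (Finset.mem_univ u),
      ← Finset.add_sum_erase (s := Finset.univ) (a := u)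
        (f := fun v => (G.neighborFinset u ∩ G.neighborFinset v).card) (Finset.mem_univ u)]
    have : ∑ v ∈ Finset.univ.erase u, (G.neighborFinset u ∩ G.neighborFinset v).card ^ 2 =
        ∑ v ∈ Finset.univ.erase u, (G.neighborFinset u ∩ G.neighborFinset v).card := by
      refine Finset.sum_congr rfl fun v hv => ?_
      have := hG.card_inter_le (Finset.ne_of_mem_erase hv).symm
      interval_cases (G.neighborFinset u ∩ G.neighborFinset v).card <;> rfl
    rw [this]
    simp only [Finset.inter_self, card_neighborFinset_eq_degree]
    ring
  have key' := Finset.sum_congr (rfl : (Finset.univ : Finset V) = Finset.univ) fun u _ => key u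
  rw [Finset.sum_add_distrib, Finset.sum_add_distrib, hsum] at key'
  rw [h4]
  have : ((∑ u, ∑ v, (G.neighborFinset u ∩ G.neighborFinset v).card ^ 2 + ∑ u, G.degree u : ℕ) : ℝ)
    = ((∑ v, G.degree v ^ 2 + ∑ v, G.degree v ^ 2 : ℕ) : ℝ) := congrArg _ key'
  push_cast at this
  rw [this]
  ring

/-- In a graph in which two distinct vertices have at most one common neighbour, equality in the
obvious bound for the number of paths of length two forces exactly one common neighbour. -/
theorem AtMostOneCommonNeighbor.card_inter_eq_one (hG : G.AtMostOneCommonNeighbor)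
    (h : ∑ v, G.degree v ^ 2 = ∑ v, G.degree v + Fintype.card V * (Fintype.card V - 1))
    {u v : V} (huv : u ≠ v) : (G.neighborFinset u ∩ G.neighborFinset v).card = 1 := by
  have hsum := G.sum_card_inter_neighborFinset
  rw [h] at hsum
  have hu (u : V) : ∑ v, (G.neighborFinset u ∩ G.neighborFinset v).card =
      G.degree u + ∑ v ∈ Finset.univ.erase u,
        (G.neighborFinset u ∩ G.neighborFinset v).card := by
    rw [← Finset.add_sum_erase _ _ (Finset.mem_univ u), Finset.inter_self,
      card_neighborFinset_eq_degree]
  simp_rw [hu, Finset.sum_add_distrib] at hsum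
  have hle (u v : V) (hv : v ∈ Finset.univ.erase u) :
      (G.neighborFinset u ∩ G.neighborFinset v).card ≤ 1 :=
    hG.card_inter_le (Finset.ne_of_mem_erase hv).symm
  have hle' (u : V) : ∑ v ∈ Finset.univ.erase u,
      (G.neighborFinset u ∩ G.neighborFinset v).card ≤ ∑ v ∈ Finset.univ.erase u, 1 :=
    Finset.sum_le_sum (hle u)
  have h1 := (Finset.sum_eq_sum_iff_of_le (s := Finset.univ) fun u _ => hle' u).1
    (by
      simp only [Finset.sum_const, Finset.card_erase_of_mem (Finset.mem_univ _), Finset.card_univ,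
        smul_eq_mul, mul_one]
      exact Nat.add_left_cancel hsum) u (Finset.mem_univ u)
  exact (Finset.sum_eq_sum_iff_of_le (hle u)).1 h1 v (by simp [huv.symm])

end Counting

section FriendshipGraph

theorem friendshipGraph_adj_none_some (n : ℕ) (p : Fin n × Bool) :
    (friendshipGraph n).Adj none (some p) := by
  simp [friendshipGraph, fromRel_adj]

theorem friendshipGraph_adj_some_some (n : ℕ) (p q : Fin n × Bool) :
    (friendshipGraph n).Adj (some p) (some q) ↔ q = (p.1, !p.2) := by
  obtain ⟨i, b⟩ := p
  obtain ⟨j, b'⟩ := q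
  cases b <;> cases b' <;> simp [friendshipGraph, fromRel_adj, eq_comm]

theorem friendshipGraph_atMostOneCommonNeighbor (n : ℕ) :
    (friendshipGraph n).AtMostOneCommonNeighbor := by
  have h0 := friendshipGraph_adj_none_some n
  have h1 := friendshipGraph_adj_some_some n
  have h2 := fun p => (h0 p).symm
  rintro (_ | ⟨i, _ | _⟩) (_ | ⟨j, _ | _⟩) (_ | ⟨k, _ | _⟩) (_ | ⟨l, _ | _⟩) <;>
    simp [h0, h1, h2] <;> grind

variable (n : ℕ) [DecidableRel (friendshipGraph n).Adj]

theorem friendshipGraph_degree_none : (friendshipGraph n).degree none = 2 * n := by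
  have : (friendshipGraph n).neighborFinset none = Finset.univ.erase none := by
    ext (_ | p) <;> simp [friendshipGraph_adj_none_some]
  rw [← card_neighborFinset_eq_degree, this, Finset.card_erase_of_mem (Finset.mem_univ _)]
  simp [mul_comm]

theorem friendshipGraph_degree_some (p : Fin n × Bool) :
    (friendshipGraph n).degree (some p) = 2 := by
  have : (friendshipGraph n).neighborFinset (some p) = {none, some (p.1, !p.2)} := by
    ext (_ | q)
    · simp [(friendshipGraph_adj_none_some n p).symm]
    · simp [friendshipGraph_adj_some_some]
  rw [← card_neighborFinset_eq_degree, this, Finset.card_pair (by simp)]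

end FriendshipGraph

section Recognition

variable {V : Type*} [Fintype V] {G : SimpleGraph V}

theorem nonempty_iso_friendshipGraph {n : ℕ} (hcard : Fintype.card V = 2 * n + 1) (c : V)
    (hc : ∀ v, v ≠ c → G.Adj c v) (hu : ∀ v, v ≠ c → ∃! w, G.Adj c w ∧ G.Adj v w) :
    Nonempty (G ≃g friendshipGraph n) := by
  classical
  have hu' : ∀ v, ∃ w, v ≠ c → w ≠ c ∧ ∀ x, x ≠ c → (G.Adj v x ↔ x = w) := by
    intro v
    by_cases hv : v = c
    · exact ⟨c, fun h => absurd hv h⟩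
    · obtain ⟨w, hw, hw'⟩ := hu v hv
      refine ⟨w, fun _ => ⟨hw.1.ne', fun x hx => ⟨fun h => hw' x ⟨hc x hx, h⟩, ?_⟩⟩⟩
      rintro rfl
      exact hw.2
  choose σ hσ using hu'
  have hσc (v) (hv : v ≠ c) : σ v ≠ c := (hσ v hv).1
  have hadj (v) (hv : v ≠ c) (x) (hx : x ≠ c) : G.Adj v x ↔ x = σ v := (hσ v hv).2 x hx
  have hσσ (v) (hv : v ≠ c) : σ (σ v) = v :=
    ((hadj _ (hσc v hv) v hv).1 ((hadj v hv _ (hσc v hv)).2 rfl).symm).symm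
  have hσne (v) (hv : v ≠ c) : σ v ≠ v := ((hadj v hv _ (hσc v hv)).2 rfl).ne'
  let f := Fintype.equivFin V
  let T := {v : V // v ≠ c ∧ f v < f (σ v)}
  let g : Option (T × Bool) → V := fun o =>
    o.elim c fun p => if p.2 then p.1.1 else σ p.1.1
  have hg : Function.Bijective g := by
    constructor
    · rintro (_ | ⟨⟨t, ht, ht'⟩, b⟩) (_ | ⟨⟨s, hs, hs'⟩, b'⟩) h
      · rfl
      · cases b' <;> simp [g] at h <;> grind
      · cases b <;> simp [g] at h <;> grind
      · cases b <;> cases b' <;> simp [g] at h ⊢ <;> grind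
    · intro v
      by_cases hv : v = c
      · exact ⟨none, hv.symm⟩
      · rcases lt_trichotomy (f v) (f (σ v)) with h | h | h
        · exact ⟨some (⟨v, hv, h⟩, true), by simp [g]⟩
        · exact absurd (f.injective h).symm (hσne v hv)
        · refine ⟨some (⟨σ v, hσc v hv, by rwa [hσσ v hv]⟩, false), by simp [g, hσσ v hv]⟩
  have hT : Fintype.card T = Fintype.card (Fin n) := by
    have := Fintype.card_of_bijective hg
    simp only [Fintype.card_option, Fintype.card_prod, Fintype.card_bool] at this
    rw [Fintype.card_fin]
    omega
  let e := Fintype.equivOfCardEq hT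
  let E : Option (Fin n × Bool) ≃ V :=
    (Equiv.optionCongr (Equiv.prodCongr e.symm (Equiv.refl Bool))).trans (Equiv.ofBijective g hg)
  have hE0 : E none = c := rfl
  have hEc (p) : E (some p) ≠ c := fun h => by
    simpa using E.injective (h.trans hE0.symm)
  have hEσ (p : Fin n × Bool) : σ (E (some p)) = E (some (p.1, !p.2)) := by
    have h (t : T) : σ (σ t.1) = t.1 := hσσ _ t.2.1
    obtain ⟨i, b⟩ := p
    cases b
    · exact h _
    · rfl
  refine ⟨(⟨E, ?_⟩ : friendshipGraph n ≃g G).symm⟩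
  rintro (_ | p) (_ | q)
  · simp
  · exact iff_of_true (hc _ (hEc q)) (friendshipGraph_adj_none_some n q)
  · exact iff_of_true (hc _ (hEc p)).symm (friendshipGraph_adj_none_some n p).symm
  · rw [hadj _ (hEc p) _ (hEc q), hEσ, E.apply_eq_iff_eq, Option.some_inj,
      friendshipGraph_adj_some_some]

theorem exists_degree_eq_two_mul [DecidableRel G.Adj] {n : ℕ} (hn : 0 < n)
    (hcard : Fintype.card V = 2 * n + 1)
    (h1 : ∑ v, G.degree v = 6 * n) (h2 : ∑ v, G.degree v ^ 2 = 4 * n ^ 2 + 8 * n)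
    (hd : ∀ v, 2 ≤ G.degree v) : ∃ v, G.degree v = 2 * n := by
  have hlt (v : V) : G.degree v ≤ 2 * n := by
    have := G.degree_lt_card_verts v
    omega
  have h0 : ∑ v, ((G.degree v : ℤ) - 2) * (2 * n - G.degree v) = 0 := by
    have h1' : ∑ v, (G.degree v : ℤ) = 6 * n := by exact_mod_cast h1
    have h2' : ∑ v, (G.degree v : ℤ) ^ 2 = 4 * n ^ 2 + 8 * n := by exact_mod_cast h2
    have (v : V) : ((G.degree v : ℤ) - 2) * (2 * n - G.degree v) =
        (2 * n + 2) * G.degree v - G.degree v ^ 2 - 4 * n := by ring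
    simp_rw [this, Finset.sum_sub_distrib, ← Finset.mul_sum, h1', h2', Finset.sum_const,
      Finset.card_univ, hcard]
    simp
    ring
  have hz := (Finset.sum_eq_zero_iff_of_nonneg fun v _ => mul_nonneg
    (by have := hd v; omega) (by have := hlt v; omega)).1 h0
  by_contra! hne
  have htwo (v : V) : G.degree v = 2 := by
    have := hne v
    rcases mul_eq_zero.1 (hz v (Finset.mem_univ v)) with h | h <;> omega
  simp only [htwo, Finset.sum_const, Finset.card_univ, hcard, smul_eq_mul] at h1
  obtain ⟨v⟩ : Nonempty V := Fintype.card_pos_iff.1 (by omega)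
  have := hne v
  have := htwo v
  omega

end Recognition

end SimpleGraph

/-- The trace of a power of the adjacency matrix is an invariant of cospectral graphs. -/
theorem Cospectral.trace_adjMatrix_pow_eq {V W : Type*} [Fintype V] [Fintype W] [DecidableEq V]
    [DecidableEq W] {G : SimpleGraph V} {H : SimpleGraph W} [DecidableRel G.Adj]
    [DecidableRel H.Adj] (h : Cospectral G H) (k : ℕ) :
    (G.adjMatrix ℝ ^ k).trace = (H.adjMatrix ℝ ^ k).trace := by
  rw [Cospectral, G.adjMat_eq_adjMatrix, H.adjMat_eq_adjMatrix] at h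
  rw [(G.isHermitian_adjMatrix ℝ).trace_pow_eq_sum_roots,
    (H.isHermitian_adjMatrix ℝ).trace_pow_eq_sum_roots, h]

theorem Cospectral.card_eq {V W : Type*} [Fintype V] [Fintype W] [DecidableEq V]
    [DecidableEq W] {G : SimpleGraph V} {H : SimpleGraph W} (h : Cospectral G H) :
    Fintype.card V = Fintype.card W := by
  rw [← (adjMat ℝ G).charpoly_natDegree_eq_dim, ← (adjMat ℝ H).charpoly_natDegree_eq_dim, h]

/-- if `G` is cospectral with the friendship graph `F n` and `G` contains no
cycle of length 4 as a (not necessarily induced) subgraph, then `G ≅ F n`. -/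
theorem cospectral_C4_free_iso
    {V : Type*} [Fintype V] [DecidableEq V]
    (n : ℕ) (hn : 0 < n) (G : SimpleGraph V)
    (hG : Cospectral G (friendshipGraph n))
    (hC4 : ¬ ∃ a b c d : V, a ≠ b ∧ a ≠ c ∧ a ≠ d ∧ b ≠ c ∧ b ≠ d ∧ c ≠ d ∧
      G.Adj a b ∧ G.Adj b c ∧ G.Adj c d ∧ G.Adj d a) :
    Nonempty (G ≃g friendshipGraph n) := by
  classical
  have hG' : G.AtMostOneCommonNeighbor := fun a c b d hac hab hcb had hcd => by
    by_contra hbd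
    exact hC4 ⟨a, b, c, d, hab.ne, hac, had.ne, hcb.ne', hbd, hcd.ne, hab, hcb.symm, hcd, had.symm⟩
  have hcard : Fintype.card V = 2 * n + 1 := by
    rw [hG.card_eq]
    simp [mul_comm]
  have htr2 := hG.trace_adjMatrix_pow_eq 2
  have htr4 := hG.trace_adjMatrix_pow_eq 4
  have hF4 := (SimpleGraph.friendshipGraph_atMostOneCommonNeighbor n).trace_adjMatrix_pow_four
  have hG4 := hG'.trace_adjMatrix_pow_four
  rw [SimpleGraph.trace_adjMatrix_sq, SimpleGraph.trace_adjMatrix_sq] at htr2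
  simp only [Fintype.sum_option, SimpleGraph.friendshipGraph_degree_none,
    SimpleGraph.friendshipGraph_degree_some, Finset.sum_const, Finset.card_univ, Fintype.card_prod,
    Fintype.card_fin, Fintype.card_bool, nsmul_eq_mul, Nat.cast_mul, Nat.cast_ofNat]
    at htr2 hF4
  have h1 : ∑ v, G.degree v = 6 * n := by
    have : ∑ v, (G.degree v : ℝ) = 6 * n := by linarith
    exact_mod_cast this
  have h2 : ∑ v, G.degree v ^ 2 = 4 * n ^ 2 + 8 * n := by
    have : ∑ v, (G.degree v : ℝ) ^ 2 = 4 * n ^ 2 + 8 * n := by linarith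
    exact_mod_cast this
  have hone {u v : V} (huv : u ≠ v) : ∃! w, G.Adj u w ∧ G.Adj v w := by
    have := hG'.card_inter_eq_one (by rw [h1, h2, hcard, Nat.add_sub_cancel]; ring) huv
    obtain ⟨w, hw⟩ := Finset.card_eq_one.1 this
    have hmem (x : V) : G.Adj u x ∧ G.Adj v x ↔ x = w := by
      simpa using Finset.ext_iff.1 hw x
    exact ⟨w, (hmem w).2 rfl, fun x => (hmem x).1⟩
  have hd (v : V) : 2 ≤ G.degree v := by
    have : Nontrivial V := Fintype.one_lt_card_iff_nontrivial.1 (by omega)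
    obtain ⟨u, hu⟩ := exists_ne v
    obtain ⟨x, ⟨hx, -⟩, -⟩ := hone hu.symm
    obtain ⟨y, ⟨hy, hxy⟩, -⟩ := hone hx.ne
    rw [← G.card_neighborFinset_eq_degree, ← Finset.card_pair hxy.ne]
    exact Finset.card_le_card (by simp [Finset.insert_subset_iff, hx, hy])
  obtain ⟨c, hc⟩ := SimpleGraph.exists_degree_eq_two_mul hn hcard h1 h2 hd
  have hN : G.neighborFinset c = Finset.univ.erase c := by
    refine Finset.eq_of_subset_of_card_le (fun v hv => ?_) ?_
    · simpa using (G.ne_of_adj ((G.mem_neighborFinset c v).1 hv)).symm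
    · rw [Finset.card_erase_of_mem (Finset.mem_univ c), Finset.card_univ, hcard,
        G.card_neighborFinset_eq_degree, hc, Nat.add_sub_cancel]
  refine SimpleGraph.nonempty_iso_friendshipGraph hcard c (fun v hv => ?_) fun v hv => hone hv.symm
  rw [← G.mem_neighborFinset, hN]
  simp [hv]
end

section
/- Let G be a finite simple graph with adjacency matrix A. Then the number of closed walks of length 5 in G satisfies tr(A^5) = 30·N(C_3) + 10·N(C_5) + 10·N(C_3^*), where N(C_3) is the number of subgraphs of G isomorphic to the triangle C_3, N(C_5) is the number of subgraphs of G isomorphic to the 5-cycle C_5, and N(C_3^*) is the number of subgraphs of G isomorphic to the paw C_3^* (a triangle with one pendant edge attached). -/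
open Polynomial

/-- The number of subgraphs of `G` (pairs of a vertex subset and an edge subset of `G`)
isomorphic to a fixed graph `H`. -/
noncomputable def subgraphCount {V : Type*} [Fintype V] (G : SimpleGraph V)
    {W : Type*} (H : SimpleGraph W) : ℕ :=
  Nat.card {G' : G.Subgraph // Nonempty (G'.coe ≃g H)}

/-- The paw graph `C₃*`: a triangle with one pendant edge attached. -/
def pawGraph : SimpleGraph (Fin 4) :=
  SimpleGraph.fromRel (fun u v =>
    (u = 0 ∧ v = 1) ∨ (u = 0 ∧ v = 2) ∨ (u = 1 ∧ v = 2) ∨ (u = 2 ∧ v = 3))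

instance : DecidableRel pawGraph.Adj := fun u v => by
  unfold pawGraph
  simp only [SimpleGraph.fromRel_adj]
  infer_instance

namespace SimpleGraph

variable {V W : Type*} {G : SimpleGraph V} {H : SimpleGraph W}

/-- The labelled copies of `H` in `G` with image `G'` are a torsor under the automorphisms
of `H`. -/
theorem card_copy_toSubgraph_eq {G' : G.Subgraph} (e : G'.coe ≃g H) :
    Nat.card {f : Copy H G // f.toSubgraph = G'} = Nat.card (H ≃g H) := by
  symm
  refine Nat.card_eq_of_bijective
    (fun σ : H ≃g H => ⟨G'.coeCopy.comp (Iso.toCopy (σ.trans e.symm)), ?_⟩) ⟨?_, ?_⟩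
  · have := (σ.trans e.symm).surjective
    ext v w
    · simp only [Subgraph.map_verts, Subgraph.verts_top, Set.image_univ, Set.mem_range]
      constructor
      · rintro ⟨a, rfl⟩
        exact Subtype.property _
      · intro hv
        obtain ⟨a, ha⟩ := this ⟨v, hv⟩
        exact ⟨a, congrArg Subtype.val ha⟩
    · simp only [Subgraph.map_adj, Subgraph.top_adj, Relation.Map]
      constructor
      · rintro ⟨a, b, hab, rfl, rfl⟩
        exact (Iso.map_adj_iff (σ.trans e.symm)).2 hab
      · intro hvw
        obtain ⟨a, ha⟩ := this ⟨v, G'.edge_vert hvw⟩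
        obtain ⟨b, hb⟩ := this ⟨w, G'.edge_vert hvw.symm⟩
        refine ⟨a, b, ?_, congrArg Subtype.val ha, congrArg Subtype.val hb⟩
        rw [← Iso.map_adj_iff (σ.trans e.symm), ha, hb]
        exact hvw
  · intro σ τ h
    ext a
    have h1 := DFunLike.congr_fun (congrArg Subtype.val h) a
    exact e.symm.injective (Subtype.val_injective h1)
  · rintro ⟨f, rfl⟩
    refine ⟨f.isoToSubgraph.trans e, Subtype.ext (Copy.ext fun a => ?_)⟩
    change ((e.symm (e (f.isoToSubgraph a))).1 : V) = f a
    rw [e.symm_apply_apply]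
    rfl

/-- A finite graph has `|Aut H|` labelled copies of `H` for each subgraph
isomorphic to `H`. -/
theorem card_copy_eq_mul_subgraphCount [Fintype V] [Finite W] (G : SimpleGraph V)
    (H : SimpleGraph W) :
    Nat.card (Copy H G) = Nat.card (H ≃g H) * subgraphCount G H := by
  classical
  have : Finite (Copy H G) := DFunLike.finite _
  let F : Copy H G → {G' : G.Subgraph // Nonempty (G'.coe ≃g H)} :=
    fun f => ⟨f.toSubgraph, ⟨f.isoToSubgraph.symm⟩⟩
  have := Fintype.ofFinite {G' : G.Subgraph // Nonempty (G'.coe ≃g H)}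
  rw [← Nat.card_congr (Equiv.sigmaFiberEquiv F), Nat.card_sigma, subgraphCount,
    Nat.card_eq_fintype_card (α := {G' : G.Subgraph // Nonempty (G'.coe ≃g H)})]
  rw [Finset.sum_const_nat (m := Nat.card (H ≃g H)), Finset.card_univ, mul_comm]
  rintro ⟨G', ⟨e⟩⟩ -
  rw [← card_copy_toSubgraph_eq e]
  exact Nat.card_congr (Equiv.subtypeEquivRight fun f => Subtype.ext_iff)

/-- `y` is the vertex map of a labelled copy of `H` in `G`. -/
def IsCopyMap (H : SimpleGraph W) (G : SimpleGraph V) (y : W → V) : Prop :=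
  Function.Injective y ∧ ∀ i j, H.Adj i j → G.Adj (y i) (y j)

theorem card_copy_eq_card_filter [Fintype V] [Fintype W] [DecidableEq W] (G : SimpleGraph V)
    (H : SimpleGraph W) [DecidablePred (H.IsCopyMap G)] :
    Nat.card (Copy H G) = Finset.card {y : W → V | H.IsCopyMap G y} := by
  rw [← Fintype.card_subtype, ← Nat.card_eq_fintype_card]
  exact Nat.card_congr
    { toFun f := ⟨f, f.injective, fun _ _ h => f.toHom.map_adj h⟩
      invFun y := ⟨⟨y.1, fun {_ _} h => y.2.2 _ _ h⟩, y.2.1⟩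
      left_inv _ := rfl
      right_inv _ := rfl }

theorem card_aut_eq_card_perm [Fintype W] [DecidableEq W] (H : SimpleGraph W)
    [DecidableRel H.Adj] :
    Nat.card (H ≃g H) =
      Fintype.card {σ : Equiv.Perm W // ∀ a b, H.Adj (σ a) (σ b) ↔ H.Adj a b} := by
  rw [← Nat.card_eq_fintype_card]
  exact Nat.card_congr
    { toFun f := ⟨f.toEquiv, fun _ _ => f.map_adj_iff⟩
      invFun σ := ⟨σ.1, fun {_ _} => σ.2 _ _⟩
      left_inv _ := rfl
      right_inv _ := rfl }

theorem card_aut_cycleGraph_three : Nat.card (cycleGraph 3 ≃g cycleGraph 3) = 6 := by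
  rw [card_aut_eq_card_perm]
  decide +kernel

theorem card_aut_cycleGraph_five : Nat.card (cycleGraph 5 ≃g cycleGraph 5) = 10 := by
  rw [card_aut_eq_card_perm]
  decide +kernel

theorem card_aut_pawGraph : Nat.card (pawGraph ≃g pawGraph) = 2 := by
  rw [card_aut_eq_card_perm]
  decide +kernel

/-- `x` lists the vertices of a closed walk of length 5. -/
def IsClosedWalkFive (G : SimpleGraph V) (x : Fin 5 → V) : Prop :=
  G.Adj (x 0) (x 1) ∧ G.Adj (x 1) (x 2) ∧ G.Adj (x 2) (x 3) ∧ G.Adj (x 3) (x 4) ∧ G.Adj (x 4) (x 0)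

/-- The closed walk `x` of length 5 goes around a triangle, with a detour along a pendant edge at
its first vertex. -/
def IsPawWalk (G : SimpleGraph V) (x : Fin 5 → V) : Prop :=
  G.IsClosedWalkFive x ∧ x 0 = x 2 ∧ x 1 ≠ x 3 ∧ x 1 ≠ x 4

/-- The closed walk `x` of length 5 goes around a triangle, traversing its first edge three
times in a row. -/
def IsTriangleWalk (G : SimpleGraph V) (x : Fin 5 → V) : Prop :=
  G.IsClosedWalkFive x ∧ x 0 = x 2 ∧ x 1 = x 3

open Classical in
theorem trace_adjMatrix_pow_five [Fintype V] [DecidableEq V] (G : SimpleGraph V) :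
    Matrix.trace ((G.adjMatrix ℕ) ^ 5) =
      Finset.card {x : Fin 5 → V | G.IsClosedWalkFive x} := by
  let e : (Fin 5 → V) ≃ V × V × V × V × V :=
    { toFun x := (x 0, x 1, x 2, x 3, x 4)
      invFun p := ![p.1, p.2.1, p.2.2.1, p.2.2.2.1, p.2.2.2.2]
      left_inv x := by ext i; fin_cases i <;> rfl
      right_inv _ := rfl }
  rw [Finset.card_filter, Fintype.sum_equiv e _ (fun p =>
    if G.IsClosedWalkFive (e.symm p) then 1 else 0) (fun x => by rw [e.symm_apply_apply])]
  simp only [Fintype.sum_prod_type, Matrix.trace, Matrix.diag, pow_succ', pow_zero, mul_one,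
    Matrix.mul_apply, Finset.mul_sum]
  refine Finset.sum_congr rfl fun a _ => Finset.sum_congr rfl fun b _ =>
    Finset.sum_congr rfl fun c _ => Finset.sum_congr rfl fun d _ => Finset.sum_congr rfl fun f _ => ?_
  have h : G.IsClosedWalkFive (e.symm (a, b, c, d, f)) ↔
      G.Adj a b ∧ G.Adj b c ∧ G.Adj c d ∧ G.Adj d f ∧ G.Adj f a := Iff.rfl
  simp only [adjMatrix_apply, h, ite_and, ite_mul, one_mul, zero_mul]

theorem isCopyMap_cycleGraph_five (G : SimpleGraph V) (x : Fin 5 → V) :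
    (cycleGraph 5).IsCopyMap G x ↔ G.IsClosedWalkFive x ∧
      x 0 ≠ x 2 ∧ x 1 ≠ x 3 ∧ x 2 ≠ x 4 ∧ x 3 ≠ x 0 ∧ x 4 ≠ x 1 := by
  constructor
  · rintro ⟨hx, h⟩
    refine ⟨⟨?_, ?_, ?_, ?_, ?_⟩, ?_, ?_, ?_, ?_, ?_⟩
    iterate 5 exact h _ _ (by decide)
    all_goals exact hx.ne (by decide)
  · rintro ⟨⟨h0, h1, h2, h3, h4⟩, h⟩
    have := h0.ne
    have := h1.ne
    have := h2.ne
    have := h3.ne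
    have := h4.ne
    refine ⟨fun i j hij => ?_, fun i j hij => ?_⟩
    · fin_cases i <;> fin_cases j <;> grind
    · fin_cases i <;> fin_cases j <;>
        first
          | exact absurd hij (by decide)
          | (first | exact h0 | exact h1 | exact h2 | exact h3 | exact h4)
          | (apply Adj.symm; first | exact h0 | exact h1 | exact h2 | exact h3 | exact h4)

open Classical in
theorem ite_isClosedWalkFive_eq (G : SimpleGraph V) (x : Fin 5 → V) :
    (if G.IsClosedWalkFive x then 1 else 0) =
      (if (cycleGraph 5).IsCopyMap G x then 1 else 0)
      + (∑ i : Fin 5, if G.IsPawWalk (fun j => x (j + i)) then 1 else 0)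
      + ∑ i : Fin 5, if G.IsTriangleWalk (fun j => x (j + i)) then 1 else 0 := by
  have hrot (i : Fin 5) : G.IsClosedWalkFive (fun j => x (j + i)) ↔ G.IsClosedWalkFive x := by
    fin_cases i <;> simp [IsClosedWalkFive] <;> tauto
  simp only [IsPawWalk, IsTriangleWalk, hrot, isCopyMap_cycleGraph_five]
  by_cases hx : G.IsClosedWalkFive x
  · obtain ⟨h0, h1, h2, h3, h4⟩ := id hx
    replace h0 := h0.ne
    replace h1 := h1.ne
    replace h2 := h2.ne
    replace h3 := h3.ne
    replace h4 := h4.ne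
    simp only [hx, true_and, Fin.sum_univ_five, if_true]
    simp only [Fin.isValue, Fin.reduceAdd, zero_add, add_zero]
    by_cases x 0 = x 2 <;> by_cases x 1 = x 3 <;> by_cases x 2 = x 4 <;> by_cases x 3 = x 0 <;>
      by_cases x 4 = x 1 <;> grind
  · simp [hx]

open Classical in
theorem card_isPawWalk [Fintype V] (G : SimpleGraph V) :
    Finset.card {x | G.IsPawWalk x} = Nat.card (Copy pawGraph G) := by
  rw [card_copy_eq_card_filter]
  refine Finset.card_nbij' (fun x => ![x 3, x 4, x 0, x 1])
    (fun y => ![y 2, y 3, y 2, y 0, y 1]) (fun x hx => ?_) (fun y hy => ?_) (fun x hx => ?_)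
    (fun y _ => ?_)
  · obtain ⟨⟨h0, h1, h2, h3, h4⟩, h02, h13, h14⟩ := (Finset.mem_filter.1 hx).2
    have := h0.ne
    have := h2.ne
    have := h3.ne
    have := h4.ne
    refine Finset.mem_filter.2 ⟨Finset.mem_univ _, fun i j hij => ?_, fun i j hij => ?_⟩
    · fin_cases i <;> fin_cases j <;> simp at hij ⊢ <;> grind
    · fin_cases i <;> fin_cases j <;>
        first
          | exact absurd hij (by decide)
          | (simp; grind [Adj.symm])
  · obtain ⟨hi, h⟩ := (Finset.mem_filter.1 hy).2
    refine Finset.mem_filter.2 ⟨Finset.mem_univ _, ⟨?_, ?_, ?_, ?_, ?_⟩, rfl, ?_, ?_⟩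
    iterate 5 exact h _ _ (by decide)
    all_goals exact hi.ne (by decide)
  · obtain ⟨-, h, -⟩ := (Finset.mem_filter.1 hx).2
    ext i
    fin_cases i <;> first | rfl | exact h
  · ext i
    fin_cases i <;> rfl

open Classical in
theorem card_isTriangleWalk [Fintype V] (G : SimpleGraph V) :
    Finset.card {x | G.IsTriangleWalk x} = Nat.card (Copy (cycleGraph 3) G) := by
  rw [card_copy_eq_card_filter]
  refine Finset.card_nbij' (fun x => ![x 0, x 1, x 4])
    (fun y => ![y 0, y 1, y 0, y 1, y 2]) (fun x hx => ?_) (fun y hy => ?_) (fun x hx => ?_)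
    (fun y _ => ?_)
  · obtain ⟨⟨h0, h1, h2, h3, h4⟩, h02, h13⟩ := (Finset.mem_filter.1 hx).2
    have := h0.ne
    have := h3.ne
    have := h4.ne
    refine Finset.mem_filter.2 ⟨Finset.mem_univ _, fun i j hij => ?_, fun i j hij => ?_⟩
    · fin_cases i <;> fin_cases j <;> simp at hij ⊢ <;> grind
    · fin_cases i <;> fin_cases j <;>
        first
          | exact absurd hij (by decide)
          | (simp; grind [Adj.symm])
  · obtain ⟨hi, h⟩ := (Finset.mem_filter.1 hy).2
    refine Finset.mem_filter.2 ⟨Finset.mem_univ _, ⟨?_, ?_, ?_, ?_, ?_⟩, rfl, rfl⟩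
    all_goals exact h _ _ (by decide)
  · obtain ⟨-, h, h'⟩ := (Finset.mem_filter.1 hx).2
    ext i
    fin_cases i <;> first | rfl | exact h | exact h'
  · ext i
    fin_cases i <;> rfl

open Classical in
theorem sum_card_rotate [Fintype V] (P : (Fin 5 → V) → Prop) :
    ∑ x : Fin 5 → V, ∑ i : Fin 5, (if P (fun j => x (j + i)) then 1 else 0) =
      5 * Finset.card {x | P x} := by
  rw [Finset.sum_comm, Finset.sum_const_nat (m := Finset.card {x | P x})]
  · rfl
  · intro i _
    rw [Finset.card_filter]
    exact Fintype.sum_equiv ((Equiv.addRight i).symm.arrowCongr (Equiv.refl V)) _ _ fun x => rfl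

end SimpleGraph


/-- for a finite simple graph `G` with adjacency matrix `A`, the number of
closed walks of length 5 satisfies `tr(A⁵) = 30·N(C₃) + 10·N(C₅) + 10·N(C₃*)`. -/
theorem trace_adj_pow_five
    {V : Type*} [Fintype V] [DecidableEq V] (G : SimpleGraph V) :
    Matrix.trace ((adjMat ℕ G) ^ 5)
      = 30 * subgraphCount G (SimpleGraph.cycleGraph 3)
        + 10 * subgraphCount G (SimpleGraph.cycleGraph 5)
        + 10 * subgraphCount G pawGraph := by
  classical
  have h : adjMat ℕ G = G.adjMatrix ℕ := by
    unfold adjMat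
    congr!
  have h3 := G.card_copy_eq_mul_subgraphCount (SimpleGraph.cycleGraph 3)
  have h5 := G.card_copy_eq_mul_subgraphCount (SimpleGraph.cycleGraph 5)
  have hp := G.card_copy_eq_mul_subgraphCount pawGraph
  rw [SimpleGraph.card_aut_cycleGraph_three, ← SimpleGraph.card_isTriangleWalk] at h3
  rw [SimpleGraph.card_aut_cycleGraph_five, SimpleGraph.card_copy_eq_card_filter,
    Finset.card_filter] at h5
  rw [SimpleGraph.card_aut_pawGraph, ← SimpleGraph.card_isPawWalk] at hp
  have key := G.trace_adjMatrix_pow_five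
  rw [Finset.card_filter, Finset.sum_congr rfl fun x _ => G.ite_isClosedWalkFive_eq x,
    Finset.sum_add_distrib, Finset.sum_add_distrib, SimpleGraph.sum_card_rotate,
    SimpleGraph.sum_card_rotate, h3, h5, hp] at key
  rw [h]
  linarith
end

section
/- Let n be a positive integer and let G be a connected graph cospectral with the friendship graph F_n. Then the number d_2(G) of vertices of G of degree 2 satisfies d_2(G) ≥ 1 + λ_max, where λ_max = (1+√(1+8n))/2 is the largest adjacency eigenvalue of F_n. -/
open Polynomial

section SpectralTools

open Matrix

variable {V : Type*} [Fintype V] [DecidableEq V] {A : Matrix V V ℝ}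

/-- A polynomial in a Hermitian matrix is conjugate to the diagonal matrix of its values at the
eigenvalues. -/
lemma Matrix.IsHermitian.aeval_eq_conj (hA : A.IsHermitian) (p : ℝ[X]) :
    aeval A p = Unitary.conjStarAlgAut ℝ _ hA.eigenvectorUnitary
      (diagonal fun i => p.eval (hA.eigenvalues i)) := by
  have hs := hA.spectral_theorem
  have hd : diagonal (fun i => p.eval (hA.eigenvalues i))
      = aeval (diagonal hA.eigenvalues) p := by
    have := aeval_algHom_apply (diagonalAlgHom (n := V) (α := ℝ) ℝ) hA.eigenvalues p
    simp only [diagonalAlgHom_apply] at this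
    rw [this]
    congr 1
    funext i
    simp
  rw [hd]
  conv_lhs => rw [hs]
  exact aeval_algHom_apply
    (Unitary.conjStarAlgAut ℝ (Matrix V V ℝ) hA.eigenvectorUnitary).toAlgEquiv.toAlgHom _ p

lemma Matrix.IsHermitian.isRoot_eigenvalues (hA : A.IsHermitian) (i : V) :
    A.charpoly.IsRoot (hA.eigenvalues i) := by
  rw [← mem_spectrum_iff_isRoot_charpoly]
  exact hA.eigenvalues_mem_spectrum_real i

/-- A polynomial vanishing at all roots of the characteristic polynomial annihilates `A`. -/
lemma Matrix.IsHermitian.aeval_eq_zero (hA : A.IsHermitian) {p : ℝ[X]}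
    (hp : ∀ x, A.charpoly.IsRoot x → p.eval x = 0) : aeval A p = 0 := by
  rw [hA.aeval_eq_conj]
  simp [hp _ (hA.isRoot_eigenvalues _)]

lemma Matrix.IsHermitian.posSemidef_aeval (hA : A.IsHermitian) {p : ℝ[X]}
    (hp : ∀ x, A.charpoly.IsRoot x → 0 ≤ p.eval x) : (aeval A p).PosSemidef := by
  rw [hA.aeval_eq_conj, Unitary.conjStarAlgAut_apply]
  exact (PosSemidef.diagonal fun i => hp _ (hA.isRoot_eigenvalues i)).mul_mul_conjTranspose_same _

lemma Matrix.IsHermitian.trace_sq (hA : A.IsHermitian) :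
    (A ^ 2).trace = (A.charpoly.roots.map (· ^ 2)).sum := by
  have h := hA.aeval_eq_conj (X ^ 2)
  rw [map_pow, aeval_X] at h
  rw [h, Unitary.conjStarAlgAut_apply, trace_mul_cycle, hA.roots_charpoly_eq_eigenvalues]
  simp [trace_diagonal]

end SpectralTools

section Friendship

open Matrix

lemma friendshipGraph_adj_none_some (n : ℕ) (x : Fin n × Bool) :
    (friendshipGraph n).Adj none (some x) := by
  simp [friendshipGraph]

lemma friendshipGraph_adj_some_some (n : ℕ) (i j : Fin n) (a b : Bool) :
    (friendshipGraph n).Adj (some (i, a)) (some (j, b)) ↔ i = j ∧ a ≠ b := by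
  cases a <;> cases b <;> simp [friendshipGraph, eq_comm]

lemma adjMat_isHermitian {V : Type*} [Fintype V] (G : SimpleGraph V) :
    (adjMat ℝ G).IsHermitian := by
  ext i j
  by_cases h : G.Adj i j
  · simp [adjMat, h, h.symm]
  · simp [adjMat, h, mt SimpleGraph.Adj.symm h]

lemma adjMat_friendshipGraph_some_some (n : ℕ) (i j : Fin n) (a b : Bool) :
    adjMat ℝ (friendshipGraph n) (some (i, a)) (some (j, b)) = if i = j ∧ a ≠ b then 1 else 0 := by
  simp [adjMat, SimpleGraph.adjMatrix_apply, friendshipGraph_adj_some_some]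

lemma adjMat_friendshipGraph_none_some (n : ℕ) (x : Fin n × Bool) :
    adjMat ℝ (friendshipGraph n) none (some x) = 1 := by
  simp [adjMat, SimpleGraph.adjMatrix_apply, friendshipGraph_adj_none_some]

lemma adjMat_friendshipGraph_some_none (n : ℕ) (x : Fin n × Bool) :
    adjMat ℝ (friendshipGraph n) (some x) none = 1 := by
  simp [adjMat, SimpleGraph.adjMatrix_apply, (friendshipGraph_adj_none_some n x).symm]

lemma adjMat_apply_self {V : Type*} [Fintype V] (G : SimpleGraph V) (v : V) :
    adjMat ℝ G v v = 0 := by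
  simp [adjMat, SimpleGraph.adjMatrix_apply]

/-- Every adjacency eigenvalue of `F n` is `1`, `-1` or a root of `x² - x - 2n`. -/
lemma friendshipGraph_isRoot (n : ℕ) {x : ℝ}
    (hx : (adjMat ℝ (friendshipGraph n)).charpoly.IsRoot x) :
    (x ^ 2 - 1) * (x ^ 2 - x - 2 * n) = 0 := by
  rw [← mem_spectrum_iff_isRoot_charpoly, ← spectrum_toLin',
    ← Module.End.hasEigenvalue_iff_mem_spectrum] at hx
  obtain ⟨w, hw⟩ := hx.exists_hasEigenvector
  have hmul := hw.apply_eq_smul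
  have hnone := congrFun hmul none
  have hsome : ∀ i a, w none + w (some (i, !a)) = x * w (some (i, a)) := by
    intro i a
    have := congrFun hmul (some (i, a))
    cases a <;>
    simpa [mulVec, dotProduct, Fintype.sum_option, Fintype.sum_prod_type,
      adjMat_friendshipGraph_some_none, adjMat_friendshipGraph_some_some] using this
  simp [mulVec, dotProduct, Fintype.sum_option, adjMat_friendshipGraph_none_some,
    adjMat_apply_self, Fintype.sum_prod_type] at hnone
  by_contra hne
  have h1 : x - 1 ≠ 0 := fun h => hne (by linear_combination (x + 1) * (x ^ 2 - x - 2 * n) * h)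
  have h2 : x + 1 ≠ 0 := fun h => hne (by linear_combination (x - 1) * (x ^ 2 - x - 2 * n) * h)
  have h3 : x ^ 2 - x - 2 * n ≠ 0 := fun h => hne (by rw [h, mul_zero])
  have hsome' : ∀ i a, (x - 1) * w (some (i, a)) = w none := by
    intro i a
    have e1 := hsome i a
    have e2 := hsome i (!a)
    rw [Bool.not_not] at e2
    apply mul_left_cancel₀ h2
    linear_combination -x * e1 - e2
  have hzero : w none = 0 := by
    apply mul_left_cancel₀ h3
    have hs : (x - 1) * ∑ i : Fin n, (w (some (i, true)) + w (some (i, false)))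
        = 2 * n * w none := by
      rw [Finset.mul_sum]
      simp only [mul_add, hsome']
      simp
      ring
    rw [hnone] at hs
    linear_combination hs
  refine hw.2 (funext fun v => ?_)
  rcases v with _ | ⟨i, a⟩
  · exact hzero
  · apply mul_left_cancel₀ h1
    rw [hsome', hzero]
    simp

lemma trace_adjMat_sq_friendshipGraph (n : ℕ) :
    (adjMat ℝ (friendshipGraph n) ^ 2).trace = 6 * n := by
  simp [pow_two, trace, mul_apply, Fintype.sum_option, Fintype.sum_prod_type,
    adjMat_friendshipGraph_none_some, adjMat_friendshipGraph_some_none, adjMat_apply_self,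
    adjMat_friendshipGraph_some_some]
  ring

end Friendship

section Counting

variable {V : Type*} [Fintype V] (G : SimpleGraph V) [DecidableRel G.Adj]

lemma adjMat_eq : adjMat ℝ G = G.adjMatrix ℝ := by
  unfold adjMat
  congr!

variable [DecidableEq V]

/-- The number of common neighbours of two vertices. -/
def codegree (x y : V) : ℕ := (G.neighborFinset x ∩ G.neighborFinset y).card

/-- The numerical consequences of being cospectral with `F n` used in the degree count: order,
size, positivity of the `2 × 2` principal minors of `A² - 1`, and the diagonal of the equation
`(A² - 1)(A² - A - 2n) = 0`. -/
structure FriendshipLike (n : ℕ) : Prop where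
  card_eq : Fintype.card V = 2 * n + 1
  sum_degree : ∑ v, G.degree v = 6 * n
  codegree_sq_le : ∀ u v, u ≠ v → 0 < G.degree u → 0 < G.degree v →
    codegree G u v ^ 2 ≤ (G.degree u - 1) * (G.degree v - 1)
  closed_walks : ∀ v, ∑ x ∈ G.neighborFinset v, ∑ y ∈ G.neighborFinset v, codegree G x y + 2 * n =
    ∑ x ∈ G.neighborFinset v, ∑ y ∈ G.neighborFinset v, (if G.Adj x y then 1 else 0) +
      (2 * n + 1) * G.degree v

lemma adjMatrix_sq_apply (x y : V) : (G.adjMatrix ℝ ^ 2) x y = codegree G x y := by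
  rw [pow_two, SimpleGraph.adjMatrix_mul_apply]
  simp only [SimpleGraph.adjMatrix_apply, Finset.sum_boole, codegree]
  congr 2
  ext z
  simp [G.adj_comm]

lemma codegree_self (x : V) : codegree G x x = G.degree x := by
  simp [codegree]

lemma codegree_comm (x y : V) : codegree G x y = codegree G y x := by
  rw [codegree, codegree, Finset.inter_comm]

/-- A graph cospectral with `F n` has the numerical properties collected in `FriendshipLike`. -/
lemma Cospectral.friendshipLike {n : ℕ} (hn : 0 < n) (hG : Cospectral G (friendshipGraph n)) :
    FriendshipLike G n := by
  have hA : (adjMat ℝ G).IsHermitian := adjMat_isHermitian G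
  have hroot : ∀ x, (adjMat ℝ G).charpoly.IsRoot x → (x ^ 2 - 1) * (x ^ 2 - x - 2 * n) = 0 :=
    fun x hx => friendshipGraph_isRoot n (by rw [← hG]; exact hx)
  have hn' : (1 : ℝ) ≤ n := by exact_mod_cast hn
  have hpsd := hA.posSemidef_aeval (p := X ^ 2 - 1) (by
    intro x hx
    simp only [eval_sub, eval_pow, eval_X, eval_one]
    rcases mul_eq_zero.1 (hroot x hx) with h | h
    · exact h.ge
    · by_contra! hlt
      nlinarith [sq_nonneg (x + 1)])
  obtain ⟨m, hm⟩ : ∃ m : ℝ, m = 2 * n := ⟨_, rfl⟩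
  have hzero := hA.aeval_eq_zero (p := (X ^ 2 - 1) * (X ^ 2 - X - C m)) (by
    intro x hx
    simpa [hm] using hroot x hx)
  have htr : (adjMat ℝ G ^ 2).trace = 6 * n := by
    rw [hA.trace_sq, hG, ← (adjMat_isHermitian (friendshipGraph n)).trace_sq,
      trace_adjMat_sq_friendshipGraph]
  have hcard : Fintype.card V = Fintype.card (Option (Fin n × Bool)) := by
    rw [← Matrix.charpoly_natDegree_eq_dim (adjMat ℝ G), hG, Matrix.charpoly_natDegree_eq_dim]
  rw [adjMat_eq] at hpsd hzero htr
  refine ⟨?_, ?_, ?_, ?_⟩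
  · rw [hcard]
    simp
    ring
  · simp only [Matrix.trace, Matrix.diag_apply, adjMatrix_sq_apply, codegree_self] at htr
    exact_mod_cast htr
  · intro u v huv hu hv
    have hdet := (hpsd.submatrix ![u, v]).det_nonneg
    simp only [Matrix.det_fin_two, Matrix.submatrix_apply, map_sub, map_pow, aeval_X, map_one,
      Matrix.sub_apply, adjMatrix_sq_apply, codegree_self, Matrix.cons_val_zero,
      Matrix.cons_val_one, Matrix.one_apply, huv, huv.symm, if_true, if_false] at hdet
    rw [codegree_comm G v u] at hdet
    have : (codegree G u v : ℝ) ^ 2 ≤ ((G.degree u - 1 : ℕ) : ℝ) * ((G.degree v - 1 : ℕ) : ℝ) := by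
      rw [Nat.cast_sub hu, Nat.cast_sub hv]
      push_cast
      linarith
    exact_mod_cast this
  · intro v
    set A := G.adjMatrix ℝ
    have hpoly : A * (A ^ 2 * A) + m • 1 = A * (A * A) + (m + 1) • A ^ 2 - A := by
      simp only [map_mul, map_sub, map_pow, aeval_X, map_one, aeval_C,
        Algebra.algebraMap_eq_smul_one] at hzero
      rw [← sub_eq_zero, ← hzero]
      simp only [mul_sub, sub_mul, mul_smul_comm, mul_one, one_mul, add_smul, one_smul,
        smul_sub]
      noncomm_ring
    have hv := congrFun (congrFun hpoly v) v
    simp only [Matrix.add_apply, Matrix.sub_apply, Matrix.smul_apply, adjMatrix_sq_apply, A,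
      SimpleGraph.adjMatrix_mul_apply, SimpleGraph.mul_adjMatrix_apply, codegree_self, hm] at hv
    simp [SimpleGraph.adjMatrix_apply] at hv
    simp only [Finset.sum_boole] at hv ⊢
    exact_mod_cast hv

lemma Nat.le_of_sq_le_of_lt_sq {c m k : ℕ} (h : c ^ 2 ≤ m) (hm : m < (k + 1) ^ 2) : c ≤ k :=
  Nat.lt_succ_iff.1 (lt_of_pow_lt_pow_left₀ 2 (Nat.zero_le _) (h.trans_lt hm))

lemma Nat.two_mul_le_add_of_sq_le_mul {c a b : ℕ} (h : c ^ 2 ≤ a * b) : 2 * c ≤ a + b :=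
  by
  refine (pow_le_pow_iff_left₀ (Nat.zero_le _) (Nat.zero_le _) two_ne_zero).1 ?_
  zify at h ⊢
  nlinarith [_root_.sq_nonneg ((a : ℤ) - b)]

namespace FriendshipLike

variable {G} {n : ℕ}

lemma degree_pos (h : FriendshipLike G n) (hn : 0 < n) (hconn : G.Connected) (v : V) :
    0 < G.degree v := by
  have : Nontrivial V := Fintype.one_lt_card_iff_nontrivial.1 (by rw [h.card_eq]; omega)
  exact hconn.preconnected.degree_pos_of_nontrivial v

lemma two_le_degree (h : FriendshipLike G n) (hn : 0 < n) (hconn : G.Connected) (v : V) :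
    2 ≤ G.degree v := by
  by_contra! hlt
  have hpos := h.degree_pos hn hconn
  have hv : G.degree v = 1 := by have := hpos v; omega
  obtain ⟨p, hp⟩ := Finset.card_eq_one.1 hv
  have hvp : ∀ x, G.Adj v x ↔ x = p := fun x => by
    rw [← SimpleGraph.mem_neighborFinset, hp, Finset.mem_singleton]
  have hpv : ∀ x, G.Adj p x → x = v := by
    intro x hx
    by_contra hne
    have hle := h.codegree_sq_le v x (Ne.symm hne) (hpos v) (hpos x)
    simp only [hv, Nat.sub_self, zero_mul, nonpos_iff_eq_zero, ne_eq, OfNat.ofNat_ne_zero,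
      not_false_eq_true, pow_eq_zero_iff] at hle
    have hmem : p ∈ G.neighborFinset v ∩ G.neighborFinset x := by simp [hvp, hx.symm]
    rw [codegree, Finset.card_eq_zero] at hle
    simp [hle] at hmem
  have huniv : ∀ x, x ∈ ({v, p} : Finset V) := by
    intro x
    by_contra hx
    obtain ⟨w⟩ := hconn.preconnected v x
    obtain ⟨⟨⟨a, b⟩, hab⟩, -, ha, hb⟩ := w.exists_boundary_dart ({v, p} : Finset V)
      (by simp) (by simpa using hx)
    simp only [Finset.coe_insert, Finset.coe_singleton, Set.mem_insert_iff,
      Set.mem_singleton_iff] at ha hb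
    rcases ha with rfl | rfl
    · exact hb (Or.inr ((hvp b).1 hab))
    · exact hb (Or.inl (hpv b hab))
  have hcard := Finset.card_le_card (fun x _ => huniv x : Finset.univ ⊆ ({v, p} : Finset V))
  rw [Finset.card_univ, h.card_eq] at hcard
  have := Finset.card_le_two (a := v) (b := p)
  omega

lemma sum_degree_sub_three (h : FriendshipLike G n) (hdeg : ∀ v, 2 ≤ G.degree v) :
    ∑ v, (G.degree v - 3) + 3 = (Finset.univ.filter fun v : V => G.degree v = 2).card := by
  have hpt : ∀ v, G.degree v + (if G.degree v = 2 then 1 else 0) = (G.degree v - 3) + 3 := by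
    intro v
    have := hdeg v
    split_ifs <;> omega
  have hsum := Finset.sum_congr rfl fun v (_ : v ∈ (Finset.univ : Finset V)) => hpt v
  rw [Finset.sum_add_distrib, Finset.sum_add_distrib, h.sum_degree, Finset.sum_boole,
    Finset.sum_const, Finset.card_univ, h.card_eq, Nat.cast_id, smul_eq_mul] at hsum
  omega

lemma degree_sub_three_le (h : FriendshipLike G n) (hdeg : ∀ v, 2 ≤ G.degree v) (x : V) :
    G.degree x - 3 + 3 ≤ (Finset.univ.filter fun v : V => G.degree v = 2).card := by
  rw [← h.sum_degree_sub_three hdeg]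
  gcongr
  exact Finset.single_le_sum (f := fun v => G.degree v - 3) (fun _ _ => Nat.zero_le _)
    (Finset.mem_univ x)

lemma degree_add_degree_le (h : FriendshipLike G n) (hdeg : ∀ v, 2 ≤ G.degree v) {x y : V}
    (hxy : x ≠ y) : G.degree x - 3 + (G.degree y - 3) + 3 ≤
      (Finset.univ.filter fun v : V => G.degree v = 2).card := by
  rw [← h.sum_degree_sub_three hdeg]
  gcongr
  rw [← Finset.sum_pair (f := fun v => G.degree v - 3) hxy]
  exact Finset.sum_le_sum_of_subset (Finset.subset_univ _)

/-- The closed-walk identity at a vertex of degree two, in terms of its two neighbours. -/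
lemma exists_of_degree_eq_two (h : FriendshipLike G n) {v p : V} (hv : G.degree v = 2)
    (hvp : G.Adj v p) : ∃ q, p ≠ q ∧ G.Adj v q ∧ 1 ≤ codegree G p q ∧
      G.degree p + G.degree q + 2 * codegree G p q =
        2 * n + 2 + 2 * (if G.Adj p q then 1 else 0) := by
  obtain ⟨a, b, hab, hN⟩ := Finset.card_eq_two.1 hv
  obtain ⟨q, hpq, hN⟩ : ∃ q, p ≠ q ∧ G.neighborFinset v = {p, q} := by
    have hp : p ∈ G.neighborFinset v := by simpa using hvp
    rw [hN, Finset.mem_insert, Finset.mem_singleton] at hp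
    rcases hp with rfl | rfl
    · exact ⟨b, hab, hN⟩
    · exact ⟨a, hab.symm, by rw [hN, Finset.pair_comm]⟩
  have hvq : G.Adj v q := by
    rw [← SimpleGraph.mem_neighborFinset, hN]
    simp
  refine ⟨q, hpq, hvq, ?_, ?_⟩
  · exact Finset.card_pos.2 ⟨v, by simp [hvp.symm, hvq.symm]⟩
  · have hw := h.closed_walks v
    simp only [hN, Finset.sum_pair hpq, codegree_self, codegree_comm G q p, hv,
      SimpleGraph.irrefl, if_false, G.adj_comm q p] at hw
    omega

/-- The closed-walk identity at a vertex of degree three, in terms of its three neighbours. -/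
lemma closed_walks_of_degree_eq_three (h : FriendshipLike G n) {p x y : V} (hp : G.degree p = 3)
    (hpx : G.Adj p x) (hpy : G.Adj p y) (hxy : x ≠ y) :
    ∃ z t, x ≠ z ∧ y ≠ z ∧ G.Adj p z ∧ (∀ w, G.Adj p w → w = x ∨ w = y ∨ w = z) ∧
      G.degree x + G.degree y + G.degree z
        + 2 * (codegree G x y + codegree G x z + codegree G y z) = 2 * t + 4 * n + 3 := by
  have hsub : ({x, y} : Finset V) ⊆ G.neighborFinset p := by
    simp [Finset.insert_subset_iff, hpx, hpy]
  have hone : (G.neighborFinset p \ {x, y}).card = 1 := by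
    rw [Finset.card_sdiff_of_subset hsub, Finset.card_pair hxy,
      SimpleGraph.card_neighborFinset_eq_degree, hp]
  obtain ⟨z, hz⟩ := Finset.card_eq_one.1 hone
  have hzmem : z ∈ G.neighborFinset p \ {x, y} := by simp [hz]
  have hN : G.neighborFinset p = {x, y, z} := by
    rw [← Finset.union_sdiff_of_subset hsub, hz]
    ext w
    simp
  simp only [Finset.mem_sdiff, SimpleGraph.mem_neighborFinset, Finset.mem_insert,
    Finset.mem_singleton, not_or] at hzmem
  obtain ⟨hpz, hzx, hzy⟩ := hzmem
  refine ⟨z, (if G.Adj x y then 1 else 0) + (if G.Adj x z then 1 else 0)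
    + (if G.Adj y z then 1 else 0), Ne.symm hzx, Ne.symm hzy, hpz, fun w hw => ?_, ?_⟩
  · rw [← SimpleGraph.mem_neighborFinset, hN] at hw
    simpa using hw
  · have hw := h.closed_walks p
    have hx : x ∉ ({y, z} : Finset V) := by simp [hxy, Ne.symm hzx]
    simp only [hN, Finset.sum_insert hx, Finset.sum_pair (Ne.symm hzy), codegree_self,
      codegree_comm G y x, codegree_comm G z x, codegree_comm G z y, hp, SimpleGraph.irrefl,
      if_false, G.adj_comm y x, G.adj_comm z x, G.adj_comm z y] at hw
    omega

/-- In a connected graph with few vertices of degree two, some vertex of degree two is adjacent to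
a vertex of larger degree. -/
lemma exists_adj_degree (h : FriendshipLike G n) (hconn : G.Connected)
    (hdeg : ∀ v, 2 ≤ G.degree v)
    (hlt : (Finset.univ.filter fun v : V => G.degree v = 2).card < 2 * n + 1) :
    ∃ v p, G.degree v = 2 ∧ 3 ≤ G.degree p ∧ G.Adj v p := by
  have hpos := h.sum_degree_sub_three hdeg
  obtain ⟨a, ha⟩ := Finset.card_pos.1 (by omega :
    0 < (Finset.univ.filter fun v : V => G.degree v = 2).card)
  obtain ⟨b, hb⟩ : ∃ b, G.degree b ≠ 2 := by
    by_contra! hall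
    rw [Finset.filter_true_of_mem fun v _ => hall v, Finset.card_univ, h.card_eq] at hlt
    exact lt_irrefl _ hlt
  obtain ⟨w⟩ := hconn.preconnected a b
  obtain ⟨⟨⟨v, p⟩, hvp⟩, -, hv, hp⟩ := w.exists_boundary_dart {v | G.degree v = 2}
    (by simpa using ha) hb
  have hp' : G.degree p ≠ 2 := hp
  exact ⟨v, p, hv, by have := hdeg p; omega, hvp⟩

lemma four_le_of_two (h : FriendshipLike G 2) (hconn : G.Connected)
    (hdeg : ∀ v, 2 ≤ G.degree v) :
    4 ≤ (Finset.univ.filter fun v : V => G.degree v = 2).card := by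
  by_contra! hlt
  have hle : ∀ x, G.degree x ≤ 3 := fun x => by
    have := h.degree_sub_three_le hdeg x
    omega
  obtain ⟨v, p, hv, hp3, hvp⟩ := h.exists_adj_degree hconn hdeg (by omega)
  have hp : G.degree p = 3 := le_antisymm (hle p) hp3
  have key : ∀ u, G.degree u = 2 → G.Adj u p →
      ∃ q, G.degree q = 3 ∧ G.Adj u q ∧ G.Adj p q ∧ codegree G p q = 1 := by
    intro u hu hup
    obtain ⟨q, -, huq, hc, heq⟩ := h.exists_of_degree_eq_two hu hup
    have h2 := hdeg q
    have h3 := hle q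
    split_ifs at heq with hpq
    · exact ⟨q, by omega, huq, hpq, by omega⟩
    · omega
  obtain ⟨q, hq, hvq, hpq, hc⟩ := key v hv hvp
  obtain ⟨y, t, hvy, hqy, hpy, hcover, heq⟩ :=
    h.closed_walks_of_degree_eq_three hp hvp.symm hpq hvq.ne
  have hy : G.degree y = 2 := by
    have := hdeg y
    have := hle y
    omega
  obtain ⟨q', hq', hyq', hpq', -⟩ := key y hy hpy.symm
  have hqq : q' = q := by
    rcases hcover q' hpq' with rfl | rfl | rfl
    · omega
    · rfl
    · omega
  subst hqq
  have hsub : ({v, y} : Finset V) ⊆ G.neighborFinset p ∩ G.neighborFinset q' := by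
    simp [Finset.insert_subset_iff, hvp.symm, hvq.symm, hpy, hyq'.symm]
  have := Finset.card_le_card hsub
  rw [Finset.card_pair hvy] at this
  unfold codegree at hc
  omega

/-- For `n = 3, 4` and few vertices of degree two, the closed-walk identity fails at a vertex of
degree three adjacent to a vertex of degree two. -/
lemma false_of_degree_eq_three (h : FriendshipLike G n) (hdeg : ∀ v, 2 ≤ G.degree v)
    (hn : n = 3 ∨ n = 4)
    (hD : (Finset.univ.filter fun v : V => G.degree v = 2).card ≤ n) {v p : V}
    (hv : G.degree v = 2) (hp : G.degree p = 3) (hvp : G.Adj v p) : False := by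
  have hpos : ∀ x, 0 < G.degree x := fun x => by have := hdeg x; omega
  have hlt : 1 < (G.neighborFinset p).card := by
    rw [SimpleGraph.card_neighborFinset_eq_degree]
    omega
  obtain ⟨y, hy, hyv⟩ := Finset.exists_mem_ne hlt v
  rw [SimpleGraph.mem_neighborFinset] at hy
  obtain ⟨z, t, hvz, hyz, -, -, heq⟩ :=
    h.closed_walks_of_degree_eq_three hp hvp.symm hy (Ne.symm hyv)
  have hsum := h.degree_add_degree_le hdeg hyz
  have hvy := h.codegree_sq_le v y (Ne.symm hyv) (hpos v) (hpos y)
  have hvz := h.codegree_sq_le v z hvz (hpos v) (hpos z)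
  have hyz := h.codegree_sq_le y z hyz (hpos y) (hpos z)
  have hy2 := hdeg y
  have hz2 := hdeg z
  generalize G.degree y = a at *
  generalize G.degree z = b at *
  generalize codegree G v y = c₁ at *
  generalize codegree G v z = c₂ at *
  generalize codegree G y z = c₃ at *
  rw [hv] at *
  have ha : a ≤ 4 := by omega
  have hb : b ≤ 4 := by omega
  have h1 : c₁ ≤ 1 := Nat.le_of_sq_le_of_lt_sq hvy (by omega)
  have h2 : c₂ ≤ 1 := Nat.le_of_sq_le_of_lt_sq hvz (by omega)
  have h3 : c₃ ≤ 3 := Nat.le_of_sq_le_of_lt_sq hyz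
    ((Nat.mul_le_mul (by omega) (by omega) : (a - 1) * (b - 1) ≤ 3 * 3).trans_lt (by norm_num))
  interval_cases a <;> interval_cases b <;> interval_cases c₃ <;> omega

/-- The number `D` of vertices of degree two satisfies `2n ≤ (D - 1)(D - 2)`, that is, `D - 1` is at
least the positive root `λ` of `λ² - λ = 2n`. -/
lemma two_mul_le (h : FriendshipLike G n) (hn : 0 < n) (hconn : G.Connected) :
    3 ≤ (Finset.univ.filter fun v : V => G.degree v = 2).card ∧
    2 * n ≤ ((Finset.univ.filter fun v : V => G.degree v = 2).card - 1) *
      ((Finset.univ.filter fun v : V => G.degree v = 2).card - 2) := by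
  have hdeg := h.two_le_degree hn hconn
  have hpos := h.degree_pos hn hconn
  have h3 : 3 ≤ (Finset.univ.filter fun v : V => G.degree v = 2).card := by
    have := h.sum_degree_sub_three hdeg
    omega
  refine ⟨h3, ?_⟩
  set D := (Finset.univ.filter fun v : V => G.degree v = 2).card with hDdef
  obtain ⟨E, hE⟩ : ∃ E, D = E + 2 := ⟨D - 2, by omega⟩
  rw [hE, Nat.add_sub_cancel, (by omega : E + 2 - 1 = E + 1)]
  by_contra! hbad
  have hbound : ∀ k ≤ E, (k + 1) * k < 2 * n := fun k hk =>
    (Nat.mul_le_mul (by omega) hk).trans_lt hbad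
  have hED : D < 2 * n + 1 := by
    by_contra! hlt
    have := hbound (2 * n - 1) (by omega)
    rw [Nat.sub_add_cancel (by omega)] at this
    have := Nat.le_mul_of_pos_right (2 * n) (by omega : 0 < 2 * n - 1)
    omega
  obtain ⟨v, p, hv, hp3, hvp⟩ := h.exists_adj_degree hconn hdeg hED
  obtain ⟨q, hpq, -, hc, heq⟩ := h.exists_of_degree_eq_two hv hvp
  have hsum := h.degree_add_degree_le hdeg hpq
  have hcs := h.codegree_sq_le p q hpq (hpos p) (hpos q)
  have hq2 := hdeg q
  obtain ⟨t, ht, ht1⟩ : ∃ t, (if G.Adj p q then 1 else 0) = t ∧ t ≤ 1 :=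
    ⟨_, rfl, by split_ifs <;> omega⟩
  rw [ht] at heq
  rw [← hDdef] at hsum
  obtain ⟨a, ha⟩ : ∃ a, G.degree p = a + 1 := ⟨G.degree p - 1, by omega⟩
  obtain ⟨b, hb⟩ : ∃ b, G.degree q = b + 1 := ⟨G.degree q - 1, by omega⟩
  rw [ha, hb, Nat.add_sub_cancel, Nat.add_sub_cancel] at hcs
  have hamgm : 2 * codegree G p q ≤ a + b := Nat.two_mul_le_add_of_sq_le_mul hcs
  rcases (by omega : n = 1 ∨ n = 2 ∨ n = 3 ∨ n = 4 ∨ n = 5 ∨ 6 ≤ n) with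
    rfl | rfl | rfl | rfl | rfl | h6
  · have := hbound 1 (by omega)
    omega
  · have hfour := h.four_le_of_two hconn hdeg
    have := hbound 2 (by omega)
    omega
  · have hD : D ≤ 3 := by
      by_contra! hlt
      have := hbound 2 (by omega)
      omega
    exact h.false_of_degree_eq_three hdeg (Or.inl rfl) hD hv (by omega) hvp
  · have hD : D ≤ 4 := by
      by_contra! hlt
      have := hbound 3 (by omega)
      omega
    have hp : G.degree p = 3 := by
      by_contra hne
      have hb1 : b = 1 := by omega
      subst hb1
      have := Nat.le_of_sq_le_of_lt_sq (k := 1) hcs (by omega)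
      omega
    exact h.false_of_degree_eq_three hdeg (Or.inr rfl) hD hv hp hvp
  · have : E < 3 := by
      by_contra! hlt
      have := hbound 3 hlt
      omega
    omega
  · have hnE := hbound (n - 3) (by omega)
    obtain ⟨m, rfl⟩ := Nat.exists_eq_add_of_le h6
    rw [(by omega : 6 + m - 3 = m + 3)] at hnE
    nlinarith only [hnE]

end FriendshipLike

end Counting

/-- if `G` is connected and cospectral with the friendship graph `F n`, then
the number of vertices of `G` of degree 2 is at least `1 + λmax`, where
`λmax = (1+√(1+8n))/2` is the largest adjacency eigenvalue of `F n`. -/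
theorem connected_cospectral_degree_two_count
    {V : Type*} [Fintype V] [DecidableEq V]
    (n : ℕ) (hn : 0 < n) (G : SimpleGraph V) [DecidableRel G.Adj]
    (hG : Cospectral G (friendshipGraph n)) (hconn : G.Connected) :
    1 + (1 + Real.sqrt (1 + 8 * (n : ℝ))) / 2
      ≤ ((Finset.univ.filter fun v : V => G.degree v = 2).card : ℝ) := by
  obtain ⟨h3, hle⟩ := (hG.friendshipLike G hn).two_mul_le hn hconn
  set D := (Finset.univ.filter fun v : V => G.degree v = 2).card
  have hle' : (2 * n : ℝ) ≤ ((D - 1 : ℕ) : ℝ) * ((D - 2 : ℕ) : ℝ) := by exact_mod_cast hle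
  rw [Nat.cast_sub (by omega), Nat.cast_sub (by omega)] at hle'
  push_cast at hle'
  have h3' : (3 : ℝ) ≤ D := by exact_mod_cast h3
  have hsqrt : Real.sqrt (1 + 8 * (n : ℝ)) ≤ 2 * D - 3 :=
    Real.sqrt_le_iff.2 ⟨by linarith, by nlinarith⟩
  linarith
end
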